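/- Let r₀ > 0 and q ∈ (2,∞). Let f = f(r,z) : [r₀,∞) × [-π,π] → ℝ be a C¹ function satisfying ∫_{-π}^{π} ∫_{r₀}^{∞} |∇_{r,z} f(r,z)|^q r dr dz < ∞. Then there exists a constant C > 0 (depending on r₀, q, the value of this integral, and one value of f) such that |f(r,z)| ≤ C (1+r)^{1-2/q} for all (r,z) ∈ [r₀,∞) × [-π,π]. -/

import Mathlib

open MeasureTheory Real Set Filter

noncomputable section

/-- Partial derivative in the first (radial) variable. -/
def dr (f : ℝ → ℝ → ℝ) (r z : ℝ) : ℝ := deriv (fun s => f s z) r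

/-- Partial derivative in the second (vertical) variable. -/
def dzz (f : ℝ → ℝ → ℝ) (r z : ℝ) : ℝ := deriv (fun t => f r t) z

open scoped ENNReal

/-- Behaviour of the Lebesgue integral on the plane under a homothety centred at `x`. -/
lemma lintegral_comp_homothety {G : ℝ × ℝ → ℝ≥0∞} (hG : Measurable G) (x : ℝ × ℝ)
    {t : ℝ} (ht : 0 < t) :
    ∫⁻ y, G (x + t • (y - x)) = ENNReal.ofReal ((t ^ 2)⁻¹) * ∫⁻ y, G y := by
  have h1 : ∫⁻ y, G (x + t • (y - x)) = ∫⁻ y, G (x + t • y) :=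
    lintegral_sub_right_eq_self (fun y => G (x + t • y)) x
  have h2 : ∫⁻ y, G (x + t • y) = ∫⁻ y, G (x + y) ∂(Measure.map (t • ·) volume) := by
    rw [lintegral_map (by fun_prop) (by fun_prop)]
  rw [h1, h2, Measure.map_addHaar_smul volume ht.ne', lintegral_smul_measure,
    lintegral_add_left_eq_self G x]
  simp [abs_of_pos ht]

lemma lintegral_rpow_Ioo_lt_top {s : ℝ} (hs : -1 < s) :
    ∫⁻ t in Ioo (0 : ℝ) 1, ENNReal.ofReal (t ^ s) < ∞ := by
  have h : IntegrableOn (fun t : ℝ => t ^ s) (Ioo 0 1) :=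
    (intervalIntegral.integrableOn_Ioo_rpow_iff one_pos).2 hs
  refine lt_of_le_of_lt (lintegral_mono fun t => ?_) h.hasFiniteIntegral
  exact Real.ofReal_le_enorm _

/-- The averaged form of Morrey's inequality: if the oscillation of `F` about `x` is controlled
by segment integrals of `G`, its mean over `U` is controlled by the `L^q` norm of `G`. -/
lemma lintegral_enorm_sub_le_of_segment_bound {F : ℝ × ℝ → ℝ} {G : ℝ × ℝ → ℝ≥0∞}
    (hG : Measurable G) {U : Set (ℝ × ℝ)} (hU : MeasurableSet U) {x : ℝ × ℝ} {D : ℝ≥0∞} {q : ℝ}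
    (hq : 2 < q)
    (h : ∀ y ∈ U, ‖F y - F x‖ₑ ≤ ∫⁻ t in Ioo (0 : ℝ) 1, D * G (x + t • (y - x))) :
    ∫⁻ y in U, ‖F y - F x‖ₑ ≤
      D * ((∫⁻ t in Ioo (0 : ℝ) 1, ENNReal.ofReal (t ^ (-2 / q))) *
        ((∫⁻ y, G y ^ q) ^ (1 / q) * volume U ^ (1 - 1 / q))) := by
  have hq0 : 0 < q := by linarith
  have hpq : q.HolderConjugate q.conjExponent := Real.HolderConjugate.conjExponent (by linarith)
  have hconj : 1 / q.conjExponent = 1 - 1 / q := by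
    have := hpq.inv_add_inv_eq_one
    simp only [one_div]; linarith
  have hmeas : Measurable fun p : (ℝ × ℝ) × ℝ => D * G (x + p.2 • (p.1 - x)) :=
    (hG.comp (by fun_prop)).const_mul D
  calc ∫⁻ y in U, ‖F y - F x‖ₑ
      ≤ ∫⁻ y in U, ∫⁻ t in Ioo (0 : ℝ) 1, D * G (x + t • (y - x)) :=
        setLIntegral_mono' hU h
    _ = ∫⁻ t in Ioo (0 : ℝ) 1, ∫⁻ y in U, D * G (x + t • (y - x)) :=
        lintegral_lintegral_swap hmeas.aemeasurable
    _ ≤ ∫⁻ t in Ioo (0 : ℝ) 1, D * (ENNReal.ofReal (t ^ (-2 / q)) *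
          ((∫⁻ y, G y ^ q) ^ (1 / q) * volume U ^ (1 - 1 / q))) := by
        refine setLIntegral_mono' measurableSet_Ioo fun t ht => ?_
        have hGt : Measurable fun y => G (x + t • (y - x)) := hG.comp (by fun_prop)
        rw [lintegral_const_mul _ hGt]
        gcongr
        have hH := ENNReal.lintegral_mul_le_Lp_mul_Lq (volume.restrict U) hpq
          hGt.aemeasurable (aemeasurable_const (b := (1 : ℝ≥0∞)))
        simp only [Pi.mul_apply, mul_one, ENNReal.one_rpow, lintegral_one,
          Measure.restrict_apply_univ, hconj] at hH
        refine hH.trans ?_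
        rw [← mul_assoc]
        gcongr
        calc (∫⁻ y in U, G (x + t • (y - x)) ^ q) ^ (1 / q)
            ≤ (∫⁻ y, G (x + t • (y - x)) ^ q) ^ (1 / q) := by
              gcongr; exact Measure.restrict_le_self
          _ = (ENNReal.ofReal ((t ^ 2)⁻¹) * ∫⁻ y, G y ^ q) ^ (1 / q) := by
              rw [lintegral_comp_homothety (hG.pow_const q) x ht.1]
          _ = ENNReal.ofReal (t ^ (-2 / q)) * (∫⁻ y, G y ^ q) ^ (1 / q) := by
              rw [ENNReal.mul_rpow_of_nonneg _ _ (by positivity),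
                ENNReal.ofReal_rpow_of_nonneg (by positivity) (by positivity)]
              congr 2
              rw [← Real.rpow_natCast, ← Real.rpow_neg ht.1.le, ← Real.rpow_mul ht.1.le]
              congr 1
              push_cast; ring
    _ = _ := by
        rw [lintegral_const_mul _ (by fun_prop), lintegral_mul_const _ (by fun_prop)]

/-- Segment integral bound for a function that is `C¹` up to the boundary of a rectangle. -/
lemma enorm_sub_le_lintegral_segment {F : ℝ × ℝ → ℝ} {a b c d : ℝ}
    (hF : ContDiffOn ℝ 1 F (Icc a b ×ˢ Icc c d)) {x y : ℝ × ℝ}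
    (hx : x ∈ Icc a b ×ˢ Icc c d) (hy : y ∈ Ioo a b ×ˢ Ioo c d) :
    ‖F y - F x‖ₑ ≤ ∫⁻ t in Ioo (0 : ℝ) 1, ENNReal.ofReal ((b - a) + (d - c)) *
      (Ioo a b ×ˢ Ioo c d).indicator
        (fun w => ENNReal.ofReal (√((fderiv ℝ F w (1, 0)) ^ 2 + (fderiv ℝ F w (0, 1)) ^ 2)))
        (x + t • (y - x)) := by
  have hconv : Convex ℝ (Icc a b ×ˢ Icc c d) := (convex_Icc a b).prod (convex_Icc c d)
  have hint : interior (Icc a b ×ˢ Icc c d) = Ioo a b ×ˢ Ioo c d := by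
    rw [interior_prod_eq, interior_Icc, interior_Icc]
  have hγ : ∀ t : ℝ, HasDerivAt (fun t : ℝ => x + t • (y - x)) (y - x) t := fun t => by
    simpa using ((hasDerivAt_id t).smul_const (y - x)).const_add x
  have hyS : y ∈ Icc a b ×ˢ Icc c d := ⟨Ioo_subset_Icc_self hy.1, Ioo_subset_Icc_self hy.2⟩
  have hcomp : ContDiffOn ℝ 1 (fun t : ℝ => F (x + t • (y - x))) (Icc 0 1) := by
    refine hF.comp (t := Icc a b ×ˢ Icc c d) (f := fun t : ℝ => x + t • (y - x))
      (by fun_prop) fun t ht => ?_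
    exact hconv.add_smul_sub_mem hx hyS ht
  have key := enorm_sub_le_lintegral_deriv_of_contDiffOn_Icc hcomp zero_le_one
  simp only [one_smul, zero_smul, add_zero, add_sub_cancel] at key
  refine key.trans ?_
  rw [← restrict_Ioo_eq_restrict_Icc]
  refine setLIntegral_mono' measurableSet_Ioo fun t ht => ?_
  have hmem : x + t • (y - x) ∈ Ioo a b ×ˢ Ioo c d := by
    rw [← hint] at hy ⊢
    exact hconv.add_smul_sub_mem_interior hx hy (Ioo_subset_Ioc_self ht)
  have hnhds : Icc a b ×ˢ Icc c d ∈ nhds (x + t • (y - x)) := by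
    rw [mem_interior_iff_mem_nhds.symm, hint]; exact hmem
  have hdiff : DifferentiableAt ℝ F (x + t • (y - x)) :=
    ((hF.contDiffAt hnhds).differentiableAt one_ne_zero)
  have hd := hdiff.hasFDerivAt.comp_hasDerivAt t (hγ t)
  have hd' : deriv (fun t : ℝ => F (x + t • (y - x))) t =
      fderiv ℝ F (x + t • (y - x)) (y - x) := hd.deriv
  rw [hd', indicator_of_mem hmem, ← ENNReal.ofReal_mul
    (by linarith [hx.1.1, hx.1.2, hx.2.1, hx.2.2]), Real.enorm_eq_ofReal_abs]
  refine ENNReal.ofReal_le_ofReal ?_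
  set L := fderiv ℝ F (x + t • (y - x))
  have hL : L (y - x) = (y.1 - x.1) * L (1, 0) + (y.2 - x.2) * L (0, 1) := by
    have : y - x = (y.1 - x.1) • ((1 : ℝ), (0 : ℝ)) + (y.2 - x.2) • ((0 : ℝ), (1 : ℝ)) := by
      ext <;> simp
    rw [this, map_add, map_smul, map_smul, smul_eq_mul, smul_eq_mul]
  have e1 : |y.1 - x.1| ≤ b - a :=
    abs_le.2 ⟨by linarith [hx.1.2, hyS.1.1], by linarith [hx.1.1, hyS.1.2]⟩
  have e2 : |y.2 - x.2| ≤ d - c :=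
    abs_le.2 ⟨by linarith [hx.2.2, hyS.2.1], by linarith [hx.2.1, hyS.2.2]⟩
  have s1 : |L (1, 0)| ≤ √(L (1, 0) ^ 2 + L (0, 1) ^ 2) :=
    Real.abs_le_sqrt (by nlinarith [sq_nonneg (L (0, 1))])
  have s2 : |L (0, 1)| ≤ √(L (1, 0) ^ 2 + L (0, 1) ^ 2) :=
    Real.abs_le_sqrt (by nlinarith [sq_nonneg (L (1, 0))])
  rw [hL, add_mul]
  refine (abs_add_le _ _).trans ?_
  rw [abs_mul, abs_mul]
  gcongr <;> linarith [abs_nonneg (y.1 - x.1), abs_nonneg (y.2 - x.2)]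

/-- Morrey's inequality on a rectangle. -/
lemma morrey_rectangle {F : ℝ × ℝ → ℝ} {a b c d q : ℝ} (hq : 2 < q)
    (hF : ContDiffOn ℝ 1 F (Icc a b ×ˢ Icc c d)) {x y : ℝ × ℝ}
    (hx : x ∈ Icc a b ×ˢ Icc c d) (hy : y ∈ Icc a b ×ˢ Icc c d) :
    volume (Ioo a b ×ˢ Ioo c d) * ‖F x - F y‖ₑ ≤
      2 * (ENNReal.ofReal ((b - a) + (d - c)) *
        ((∫⁻ t in Ioo (0 : ℝ) 1, ENNReal.ofReal (t ^ (-2 / q))) *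
        ((∫⁻ w in Ioo a b ×ˢ Ioo c d, ENNReal.ofReal
          (((fderiv ℝ F w (1, 0)) ^ 2 + (fderiv ℝ F w (0, 1)) ^ 2) ^ (q / 2))) ^ (1 / q) *
            volume (Ioo a b ×ˢ Ioo c d) ^ (1 - 1 / q)))) := by
  set U := Ioo a b ×ˢ Ioo c d with hUdef
  have hU : MeasurableSet U := measurableSet_Ioo.prod measurableSet_Ioo
  set g : ℝ × ℝ → ℝ≥0∞ := fun w =>
    ENNReal.ofReal (√((fderiv ℝ F w (1, 0)) ^ 2 + (fderiv ℝ F w (0, 1)) ^ 2)) with hg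
  have hgm : Measurable g := by
    have h1 := measurable_fderiv_apply_const ℝ F ((1 : ℝ), (0 : ℝ))
    have h2 := measurable_fderiv_apply_const ℝ F ((0 : ℝ), (1 : ℝ))
    exact ((h1.pow_const 2).add (h2.pow_const 2)).sqrt.ennreal_ofReal
  have hint : ∫⁻ w, (U.indicator g w) ^ q = ∫⁻ w in U, ENNReal.ofReal
      (((fderiv ℝ F w (1, 0)) ^ 2 + (fderiv ℝ F w (0, 1)) ^ 2) ^ (q / 2)) := by
    rw [← lintegral_indicator hU]
    refine lintegral_congr fun w => ?_
    by_cases hw : w ∈ U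
    · simp only [indicator_of_mem hw, hg]
      rw [ENNReal.ofReal_rpow_of_nonneg (by positivity) (by linarith), Real.sqrt_eq_rpow,
        ← Real.rpow_mul (by positivity)]
      congr 2; ring
    · simp only [indicator_of_notMem hw]
      exact ENNReal.zero_rpow_of_pos (by linarith)
  have hmor : ∀ p ∈ Icc a b ×ˢ Icc c d, _ := fun p hp =>
    lintegral_enorm_sub_le_of_segment_bound (hgm.indicator hU) hU hq
      fun w hw => enorm_sub_le_lintegral_segment hF hp hw
  rw [hint] at hmor
  have hFm : AEMeasurable (fun w => ‖F w - F x‖ₑ) (volume.restrict U) := by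
    have hc : ContinuousOn F U := hF.continuousOn.mono
      (Set.prod_mono Ioo_subset_Icc_self Ioo_subset_Icc_self)
    exact ((hc.aemeasurable hU).sub_const _).enorm
  calc volume U * ‖F x - F y‖ₑ = ∫⁻ w in U, ‖F x - F y‖ₑ := by
        rw [setLIntegral_const, mul_comm]
    _ ≤ ∫⁻ w in U, (‖F w - F x‖ₑ + ‖F w - F y‖ₑ) := by
        refine lintegral_mono fun w => ?_
        have : F x - F y = (F w - F y) - (F w - F x) := by ring
        rw [this, add_comm]
        exact enorm_sub_le
    _ = (∫⁻ w in U, ‖F w - F x‖ₑ) + ∫⁻ w in U, ‖F w - F y‖ₑ := lintegral_add_left' hFm _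
    _ ≤ _ := by
        rw [two_mul]
        exact add_le_add (hmor x hx) (hmor y hy)

/-- On dyadic pieces of the slab the oscillation is at most a multiple of `ρ ^ (1 - 2 / q)`. -/
lemma exists_oscillation_bound_dyadic {r₀ q : ℝ} (hr₀ : 0 < r₀) (hq : 2 < q)
    {f : ℝ → ℝ → ℝ}
    (hf : ContDiffOn ℝ 1 (fun w : ℝ × ℝ => f w.1 w.2) (Ici r₀ ×ˢ Icc (-π) π))
    (hint : ∫⁻ w : ℝ × ℝ in Ici r₀ ×ˢ Icc (-π) π,
      ENNReal.ofReal (((dr f w.1 w.2) ^ 2 + (dzz f w.1 w.2) ^ 2) ^ (q / 2) * w.1) < ⊤) :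
    ∃ A : ℝ, 0 ≤ A ∧ ∀ ρ, r₀ ≤ ρ → ∀ x ∈ Icc ρ (2 * ρ) ×ˢ Icc (-π) π,
      ∀ y ∈ Icc ρ (2 * ρ) ×ˢ Icc (-π) π, |f x.1 x.2 - f y.1 y.2| ≤ A * ρ ^ (1 - 2 / q) := by
  set F : ℝ × ℝ → ℝ := fun w => f w.1 w.2 with hFdef
  set M := ∫⁻ w : ℝ × ℝ in Ici r₀ ×ˢ Icc (-π) π,
      ENNReal.ofReal (((dr f w.1 w.2) ^ 2 + (dzz f w.1 w.2) ^ 2) ^ (q / 2) * w.1) with hM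
  have hκ := lintegral_rpow_Ioo_lt_top (s := -2 / q)
    (by rw [lt_div_iff₀ (by linarith)]; linarith)
  set κ := ∫⁻ t in Ioo (0 : ℝ) 1, ENNReal.ofReal (t ^ (-2 / q))
  have hq0 : 0 < q := by linarith
  refine ⟨2 * (1 + 2 * π / r₀) * κ.toReal * M.toReal ^ (1 / q) * (2 * π) ^ (-(1 / q)),
    by positivity, fun ρ hρ x hx y hy => ?_⟩
  have hρ0 : 0 < ρ := hr₀.trans_le hρ
  have hsub : Icc ρ (2 * ρ) ×ˢ Icc (-π) π ⊆ Ici r₀ ×ˢ Icc (-π) π :=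
    Set.prod_mono (fun s hs => hρ.trans hs.1) subset_rfl
  have hmor := morrey_rectangle hq (hf.mono hsub) hx hy
  have hvol : volume (Ioo ρ (2 * ρ) ×ˢ Ioo (-π) π) = ENNReal.ofReal (2 * π * ρ) := by
    rw [Measure.volume_eq_prod, Measure.prod_prod, Real.volume_Ioo, Real.volume_Ioo,
      ← ENNReal.ofReal_mul (by linarith)]
    congr 1; ring
  have hgrad : ∫⁻ w in Ioo ρ (2 * ρ) ×ˢ Ioo (-π) π, ENNReal.ofReal
      (((fderiv ℝ F w (1, 0)) ^ 2 + (fderiv ℝ F w (0, 1)) ^ 2) ^ (q / 2)) ≤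
      ENNReal.ofReal (M.toReal / ρ) := by
    have hUm : MeasurableSet (Ioo ρ (2 * ρ) ×ˢ Ioo (-π) π) :=
      measurableSet_Ioo.prod measurableSet_Ioo
    have hUS : Ioo ρ (2 * ρ) ×ˢ Ioo (-π) π ⊆ Ici r₀ ×ˢ Icc (-π) π :=
      (Set.prod_mono Ioo_subset_Icc_self Ioo_subset_Icc_self).trans hsub
    calc _ ≤ ∫⁻ w in Ioo ρ (2 * ρ) ×ˢ Ioo (-π) π, ENNReal.ofReal ρ⁻¹ *
          ENNReal.ofReal (((dr f w.1 w.2) ^ 2 + (dzz f w.1 w.2) ^ 2) ^ (q / 2) * w.1) := by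
          refine setLIntegral_mono' hUm fun w hw => ?_
          have hnhds : Ici r₀ ×ˢ Icc (-π) π ∈ nhds w :=
            mem_of_superset ((isOpen_Ioo.prod isOpen_Ioo).mem_nhds hw) hUS
          have hd : HasFDerivAt F (fderiv ℝ F w) w :=
            ((hf.contDiffAt hnhds).differentiableAt one_ne_zero).hasFDerivAt
          have e1 : dr f w.1 w.2 = fderiv ℝ F w (1, 0) :=
            (hd.comp_hasDerivAt (f := fun s => (s, w.2)) w.1
              ((hasDerivAt_id w.1).prodMk (hasDerivAt_const w.1 w.2))).deriv
          have e2 : dzz f w.1 w.2 = fderiv ℝ F w (0, 1) :=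
            (hd.comp_hasDerivAt (f := fun s => (w.1, s)) w.2
              ((hasDerivAt_const w.2 w.1).prodMk (hasDerivAt_id w.2))).deriv
          rw [e1, e2, ← ENNReal.ofReal_mul (by positivity)]
          refine ENNReal.ofReal_le_ofReal ?_
          rw [inv_mul_eq_div, le_div_iff₀ hρ0]
          gcongr
          exact hw.1.1.le
      _ = ENNReal.ofReal ρ⁻¹ * ∫⁻ w in Ioo ρ (2 * ρ) ×ˢ Ioo (-π) π,
          ENNReal.ofReal (((dr f w.1 w.2) ^ 2 + (dzz f w.1 w.2) ^ 2) ^ (q / 2) * w.1) :=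
          lintegral_const_mul' _ _ ENNReal.ofReal_ne_top
      _ ≤ ENNReal.ofReal ρ⁻¹ * M := by
          gcongr
          exact lintegral_mono_set hUS
      _ = _ := by
          rw [div_eq_inv_mul, ENNReal.ofReal_mul (by positivity), ENNReal.ofReal_toReal hint.ne]
  have hq1 : 0 ≤ 1 - 1 / q := by
    rw [sub_nonneg, div_le_one hq0]; linarith
  have hpi : 0 < 2 * π * ρ := by positivity
  have hreal : 2 * π * ρ * |F x - F y| ≤ 2 * ((2 * ρ - ρ + (π - -π)) * (κ.toReal *
      ((M.toReal / ρ) ^ (1 / q) * (2 * π * ρ) ^ (1 - 1 / q)))) := by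
    rw [← ENNReal.ofReal_le_ofReal_iff (mul_nonneg zero_le_two
      (mul_nonneg (by linarith [Real.pi_pos]) (by positivity))),
      ENNReal.ofReal_mul hpi.le, ← Real.enorm_eq_ofReal_abs, ← hvol]
    refine hmor.trans ?_
    rw [ENNReal.ofReal_mul zero_le_two, ENNReal.ofReal_mul (by linarith [Real.pi_pos]),
      ENNReal.ofReal_mul ENNReal.toReal_nonneg, ENNReal.ofReal_mul (by positivity),
      ENNReal.ofReal_toReal hκ.ne, ← ENNReal.ofReal_rpow_of_nonneg (by positivity) (by positivity),
      ← ENNReal.ofReal_rpow_of_nonneg hpi.le hq1, hvol, ENNReal.ofReal_ofNat]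
    gcongr
  have hrpow : (M.toReal / ρ) ^ (1 / q) * (2 * π * ρ) ^ (1 - 1 / q) =
      2 * π * (M.toReal ^ (1 / q) * (2 * π) ^ (-(1 / q)) * ρ ^ (1 - 2 / q)) := by
    rw [Real.div_rpow ENNReal.toReal_nonneg hρ0.le, Real.mul_rpow (by positivity) hρ0.le,
      sub_eq_add_neg, Real.rpow_add (by positivity : 0 < 2 * π), Real.rpow_one,
      show 1 - 2 / q = (1 + -(1 / q)) - 1 / q by ring, Real.rpow_sub hρ0 (1 + -(1 / q))]
    ring
  have hlen : 2 * ρ - ρ + (π - -π) ≤ (1 + 2 * π / r₀) * ρ := by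
    have : 2 * π ≤ 2 * π / r₀ * ρ := by
      rw [div_mul_eq_mul_div, le_div_iff₀ hr₀]
      gcongr
    linarith
  refine le_of_mul_le_mul_left (hreal.trans ?_) hpi
  rw [hrpow]
  calc _ ≤ 2 * ((1 + 2 * π / r₀) * ρ * (κ.toReal *
        (2 * π * (M.toReal ^ (1 / q) * (2 * π) ^ (-(1 / q)) * ρ ^ (1 - 2 / q))))) := by gcongr
    _ = _ := by ring

/-- a Morrey-type growth estimate in the slab, Lemma 2.1 of the paper. -/
theorem pointwise_growth_estimate (r₀ q : ℝ) (hr₀ : 0 < r₀) (hq : 2 < q)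
    (f : ℝ → ℝ → ℝ)
    (hf : ContDiffOn ℝ 1 (fun w : ℝ × ℝ => f w.1 w.2) (Ici r₀ ×ˢ Icc (-π) π))
    (hint : ∫⁻ w : ℝ × ℝ in Ici r₀ ×ˢ Icc (-π) π,
      ENNReal.ofReal (((dr f w.1 w.2) ^ 2 + (dzz f w.1 w.2) ^ 2) ^ (q / 2) * w.1) < ⊤) :
    ∃ C : ℝ, 0 < C ∧ ∀ r ∈ Ici r₀, ∀ z ∈ Icc (-π) π,
      |f r z| ≤ C * (1 + r) ^ (1 - 2 / q) := by
  obtain ⟨A, hA, hosc⟩ := exists_oscillation_bound_dyadic hr₀ hq hf hint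
  set α := 1 - 2 / q with hα
  have hα0 : 0 < α := by
    rw [hα, sub_pos, div_lt_one (by linarith)]; exact hq
  set B := |f r₀ 0|
  have h2α : 1 < (2 : ℝ) ^ α := Real.one_lt_rpow one_lt_two hα0
  set K := B / r₀ ^ α + A + A / (2 ^ α - 1) + 1 with hK
  have hr₀α : 0 < r₀ ^ α := Real.rpow_pos_of_pos hr₀ _
  have hAd : 0 ≤ A / (2 ^ α - 1) := div_nonneg hA (by linarith)
  have hB : 0 ≤ B / r₀ ^ α := by positivity
  have hK0 : 0 < K := by positivity
  have hzero : (0 : ℝ) ∈ Icc (-π) π := ⟨by linarith [Real.pi_pos], Real.pi_pos.le⟩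
  have hAK : A ≤ K * (2 ^ α - 1) := by
    rw [← div_le_iff₀ (by linarith)]; linarith
  have main : ∀ n : ℕ, ∀ r, r₀ ≤ r → r ≤ 2 ^ (n + 1) * r₀ → ∀ z ∈ Icc (-π) π,
      |f r z| ≤ K * r ^ α := by
    intro n
    have base : ∀ r, r₀ ≤ r → r ≤ 2 * r₀ → ∀ z ∈ Icc (-π) π, |f r z| ≤ K * r ^ α := by
      intro r hr hr2 z hz
      have h := hosc r₀ le_rfl (r, z) ⟨⟨hr, hr2⟩, hz⟩ (r₀, 0)
        ⟨⟨le_rfl, by linarith⟩, hzero⟩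
      have h1 : |f r z| ≤ A * r₀ ^ α + B := by
        have := abs_sub_abs_le_abs_sub (f r z) (f r₀ 0)
        simp only at h
        linarith
      calc |f r z| ≤ (B / r₀ ^ α + A) * r₀ ^ α := by
            rw [add_mul, div_mul_cancel₀ _ hr₀α.ne']; linarith
        _ ≤ K * r ^ α := by
            gcongr
            linarith
    induction n with
    | zero => simpa using base
    | succ n ih =>
      intro r hr hrn z hz
      rcases le_total r (2 * r₀) with hr2 | hr2
      · exact base r hr hr2 z hz
      have hrpos : 0 < r := hr₀.trans_le hr
      have hhalf : r₀ ≤ r / 2 := by linarith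
      have h := hosc (r / 2) hhalf (r, z) ⟨⟨by linarith, by linarith⟩, hz⟩ (r / 2, z)
        ⟨⟨le_rfl, by linarith⟩, hz⟩
      have h' := ih (r / 2) hhalf (by rw [pow_succ] at hrn; linarith) z hz
      have h1 := abs_sub_abs_le_abs_sub (f r z) (f (r / 2) z)
      simp only at h
      have hp : 0 ≤ (r / 2) ^ α := by positivity
      have hrr : r ^ α = 2 ^ α * (r / 2) ^ α := by
        rw [← Real.mul_rpow (by norm_num) (by positivity)]
        congr 1; ring
      have := mul_le_mul_of_nonneg_right hAK hp
      rw [hrr]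
      nlinarith
  refine ⟨K, hK0, fun r hr z hz => ?_⟩
  have hr : r₀ ≤ r := hr
  have hrpos : 0 < r := hr₀.trans_le hr
  obtain ⟨n, hn⟩ := pow_unbounded_of_one_lt (r / r₀) (one_lt_two : (1 : ℝ) < 2)
  have hn' : r ≤ 2 ^ (n + 1) * r₀ := by
    rw [div_lt_iff₀ hr₀] at hn
    rw [pow_succ]
    nlinarith [pow_pos (two_pos : (0 : ℝ) < 2) n]
  refine (main n r hr hn' z hz).trans ?_
  gcongr
  linarith
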